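/- Let K ⊆ ℂ^n be a compact polynomially convex set and let p ∈ ℂ^n \ K. Then there exists r > 0 such that for every 0 < r' ≤ r, the set K ∪ B̄_p(r') is polynomially convex, where B̄_p(r') denotes the closed Euclidean ball of radius r' centered at p in ℂ^n. -/

import Mathlib

open scoped Manifold ComplexConjugate

noncomputable section

/-- Evaluation of a holomorphic polynomial on `ℂ^n`. -/
def evalPoly {n : ℕ} (P : MvPolynomial (Fin n) ℂ) (z : EuclideanSpace ℂ (Fin n)) : ℂ :=
  MvPolynomial.eval (fun i => z i) P

/-- The polynomially convex hull of a set `K ⊆ ℂ^n`. -/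
def polyHull {n : ℕ} (K : Set (EuclideanSpace ℂ (Fin n))) : Set (EuclideanSpace ℂ (Fin n)) :=
  {z | ∀ P : MvPolynomial (Fin n) ℂ, ‖evalPoly P z‖ ≤ ⨆ w ∈ K, ‖evalPoly P w‖}

/-- A set is polynomially convex if it coincides with its polynomially convex hull. -/
def IsPolyConvex {n : ℕ} (K : Set (EuclideanSpace ℂ (Fin n))) : Prop := polyHull K = K

/-- The rationally convex hull of a set `K ⊆ ℂ^n`. -/
def ratHull {n : ℕ} (K : Set (EuclideanSpace ℂ (Fin n))) : Set (EuclideanSpace ℂ (Fin n)) :=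
  {z | ∀ P : MvPolynomial (Fin n) ℂ, evalPoly P z = 0 → ∃ w ∈ K, evalPoly P w = 0}

/-- The closed half-space `{x ∈ ℝ^d : x₀ ≥ 0}`. -/
def halfSpace (d : ℕ) (hd : 0 < d) : Set (EuclideanSpace ℝ (Fin d)) :=
  {x | 0 ≤ x ⟨0, hd⟩}

/-- `M ⊆ ℂ^n` is a `d`-dimensional smooth compact submanifold (possibly with boundary):
every point admits a smooth local parametrization by a relatively open subset of the closed
half-space `H ⊆ ℝ^d`, which is an immersion and a homeomorphism onto a relatively open
subset of `M`. (Charts with image in the open half-space cover interior points, so closed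
submanifolds are included.) -/
def IsSubmanifold {n : ℕ} (d : ℕ) (hd : 0 < d) (M : Set (EuclideanSpace ℂ (Fin n))) : Prop :=
  ∀ p ∈ M, ∃ (V : Set (EuclideanSpace ℝ (Fin d))) (U : Set (EuclideanSpace ℂ (Fin n)))
    (f : EuclideanSpace ℝ (Fin d) → EuclideanSpace ℂ (Fin n)),
    IsOpen V ∧ IsOpen U ∧ p ∈ U ∧ ContDiffOn ℝ (⊤ : ℕ∞) f V ∧
    Set.InjOn f (V ∩ halfSpace d hd) ∧
    (∀ x ∈ V, Function.Injective (fderiv ℝ f x)) ∧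
    f '' (V ∩ halfSpace d hd) = M ∩ U ∧
    (∀ W, IsOpen W → W ⊆ V → ∃ U', IsOpen U' ∧ f '' (W ∩ halfSpace d hd) = M ∩ U')

/-- `p` is a boundary point of the submanifold `M`: some local parametrization as above
maps a point on the boundary of the half-space to `p`. -/
def IsBoundaryPoint {n : ℕ} (d : ℕ) (hd : 0 < d) (M : Set (EuclideanSpace ℂ (Fin n)))
    (p : EuclideanSpace ℂ (Fin n)) : Prop :=
  p ∈ M ∧ ∃ (V : Set (EuclideanSpace ℝ (Fin d))) (U : Set (EuclideanSpace ℂ (Fin n)))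
    (f : EuclideanSpace ℝ (Fin d) → EuclideanSpace ℂ (Fin n)),
    IsOpen V ∧ IsOpen U ∧ p ∈ U ∧ ContDiffOn ℝ (⊤ : ℕ∞) f V ∧
    Set.InjOn f (V ∩ halfSpace d hd) ∧
    (∀ x ∈ V, Function.Injective (fderiv ℝ f x)) ∧
    f '' (V ∩ halfSpace d hd) = M ∩ U ∧
    (∀ W, IsOpen W → W ⊆ V → ∃ U', IsOpen U' ∧ f '' (W ∩ halfSpace d hd) = M ∩ U') ∧
    ∃ x ∈ V ∩ halfSpace d hd, f x = p ∧ x ⟨0, hd⟩ = 0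

/-- The tangent space of `M ⊆ ℂ^n` at `p`, as a real subspace of `ℂ^n`. -/
def tangentSpaceAt {n : ℕ} (M : Set (EuclideanSpace ℂ (Fin n)))
    (p : EuclideanSpace ℂ (Fin n)) : Submodule ℝ (EuclideanSpace ℂ (Fin n)) :=
  Submodule.span ℝ (tangentConeAt ℝ M p)

/-- `M` is totally real at `p`: `T_pM ∩ i·T_pM = {0}`. -/
def TotallyRealAt {n : ℕ} (M : Set (EuclideanSpace ℂ (Fin n)))
    (p : EuclideanSpace ℂ (Fin n)) : Prop :=
  ∀ v ∈ tangentSpaceAt M p, Complex.I • v ∈ tangentSpaceAt M p → v = (0 : EuclideanSpace ℂ (Fin n))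

/-- The Beloshapka–Coffman normal form `𝓜_k ⊆ ℂ^{3k-1}`, in coordinates
`Z = (z, w₁, …, w_{2k-2}, ζ₁, …, ζ_k)`, `w_τ = u_τ + i v_τ`. -/
def bcForm (k : ℕ) (hk : 1 < k) : Set (EuclideanSpace ℂ (Fin (3*k-1))) :=
  {Z | (∀ τ : ℕ, ∀ _h1 : 1 ≤ τ, ∀ _h2 : τ ≤ 2*k-2, (Z ⟨τ, by omega⟩).im = 0) ∧
    Z ⟨2*k-1, by omega⟩ = (Complex.normSq (Z ⟨0, by omega⟩) : ℂ) +
      conj (Z ⟨0, by omega⟩) * (((Z ⟨1, by omega⟩).re : ℂ) + Complex.I * ((Z ⟨2, by omega⟩).re : ℂ)) ∧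
    (∀ σ : ℕ, ∀ _h1 : 2 ≤ σ, ∀ _h2 : σ ≤ k-1,
      Z ⟨2*k-2+σ, by omega⟩ = conj (Z ⟨0, by omega⟩) *
        (((Z ⟨2*σ-1, by omega⟩).re : ℂ) + Complex.I * ((Z ⟨2*σ, by omega⟩).re : ℂ))) ∧
    Z ⟨3*k-2, by omega⟩ = (conj (Z ⟨0, by omega⟩))^2}

/-- `p` is a generic CR-singularity of `M ⊆ ℂ^{3k-1}`: `(M, p)` is locally biholomorphic
to `(𝓜_k, O)`. -/
def IsGenericCRSingularity (k : ℕ) (hk : 1 < k) (M : Set (EuclideanSpace ℂ (Fin (3*k-1))))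
    (p : EuclideanSpace ℂ (Fin (3*k-1))) : Prop :=
  ∃ (U V : Set (EuclideanSpace ℂ (Fin (3*k-1))))
    (Φ Ψ : EuclideanSpace ℂ (Fin (3*k-1)) → EuclideanSpace ℂ (Fin (3*k-1))),
    IsOpen U ∧ IsOpen V ∧ p ∈ U ∧ (0 : EuclideanSpace ℂ (Fin (3*k-1))) ∈ V ∧
    DifferentiableOn ℂ Φ U ∧ DifferentiableOn ℂ Ψ V ∧
    Set.MapsTo Φ U V ∧ Set.MapsTo Ψ V U ∧
    (∀ x ∈ U, Ψ (Φ x) = x) ∧ (∀ y ∈ V, Φ (Ψ y) = y) ∧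
    Φ p = 0 ∧ Φ '' (M ∩ U) = bcForm k hk ∩ V

/-- The Laplacian at `0` of the slice function `λ ↦ ρ(p + λ·v)`. -/
def sliceLaplacian {n : ℕ} (ρ : EuclideanSpace ℂ (Fin n) → ℝ)
    (p v : EuclideanSpace ℂ (Fin n)) : ℝ :=
  iteratedFDeriv ℝ 2 (fun lam : ℂ => ρ (p + lam • v)) 0 ![1, 1]
  + iteratedFDeriv ℝ 2 (fun lam : ℂ => ρ (p + lam • v)) 0 ![Complex.I, Complex.I]

/-- `ρ` is plurisubharmonic on `U`. -/
def PshOn {n : ℕ} (ρ : EuclideanSpace ℂ (Fin n) → ℝ) (U : Set (EuclideanSpace ℂ (Fin n))) : Prop :=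
  ∀ p ∈ U, ∀ v : EuclideanSpace ℂ (Fin n), 0 ≤ sliceLaplacian ρ p v

/-- `ρ` is strictly plurisubharmonic at `p`. -/
def StrictPshAt {n : ℕ} (ρ : EuclideanSpace ℂ (Fin n) → ℝ)
    (p : EuclideanSpace ℂ (Fin n)) : Prop :=
  ∀ v : EuclideanSpace ℂ (Fin n), v ≠ 0 → 0 < sliceLaplacian ρ p v

/-- `ρ` is strictly plurisubharmonic on a set. -/
def StrictPshOn {n : ℕ} (ρ : EuclideanSpace ℂ (Fin n) → ℝ)
    (U : Set (EuclideanSpace ℂ (Fin n))) : Prop :=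
  ∀ p ∈ U, StrictPshAt ρ p

theorem continuous_evalPoly {n : ℕ} (P : MvPolynomial (Fin n) ℂ) : Continuous (evalPoly P) := by
  unfold evalPoly
  exact (MvPolynomial.continuous_eval P).comp (by fun_prop)

theorem norm_evalPoly_le_iSup {n : ℕ} {K : Set (EuclideanSpace ℂ (Fin n))} (hK : IsCompact K)
    (P : MvPolynomial (Fin n) ℂ) {z : EuclideanSpace ℂ (Fin n)} (hz : z ∈ K) :
    ‖evalPoly P z‖ ≤ ⨆ w ∈ K, ‖evalPoly P w‖ := by
  obtain ⟨C, hC⟩ := hK.exists_bound_of_continuousOn (continuous_evalPoly P).continuousOn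
  have hb : BddAbove (Set.range fun w => ⨆ _ : w ∈ K, ‖evalPoly P w‖) := by
    refine ⟨max C 0, ?_⟩
    rintro _ ⟨w, rfl⟩
    exact Real.iSup_le (fun hw => (hC w hw).trans (le_max_left _ _)) (le_max_right _ _)
  have h := le_ciSup hb z
  simpa [hz] using h

theorem subset_polyHull {n : ℕ} {K : Set (EuclideanSpace ℂ (Fin n))} (hK : IsCompact K) :
    K ⊆ polyHull K :=
  fun _ hz P => norm_evalPoly_le_iSup hK P hz

theorem norm_evalPoly_le_of_mem_polyHull {n : ℕ} {K : Set (EuclideanSpace ℂ (Fin n))}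
    {z : EuclideanSpace ℂ (Fin n)} (hz : z ∈ polyHull K) (P : MvPolynomial (Fin n) ℂ) {c : ℝ}
    (hc : 0 ≤ c) (hP : ∀ w ∈ K, ‖evalPoly P w‖ ≤ c) : ‖evalPoly P z‖ ≤ c :=
  (hz P).trans (Real.iSup_le (fun w => Real.iSup_le (hP w) hc) hc)

/-- A polynomial strictly larger at `z` than on `S` can be normalized to take the value `1`
at `z` and be arbitrarily small on `S`. -/
theorem exists_evalPoly_eq_one_of_lt {n : ℕ} {S : Set (EuclideanSpace ℂ (Fin n))}
    {z : EuclideanSpace ℂ (Fin n)} {Q : MvPolynomial (Fin n) ℂ} {c : ℝ} (hc : 0 ≤ c)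
    (hQ : ∀ w ∈ S, ‖evalPoly Q w‖ ≤ c) (hz : c < ‖evalPoly Q z‖) {ε : ℝ} (hε : 0 < ε) :
    ∃ P : MvPolynomial (Fin n) ℂ, evalPoly P z = 1 ∧ ∀ w ∈ S, ‖evalPoly P w‖ ≤ ε := by
  have hpos : 0 < ‖evalPoly Q z‖ := hc.trans_lt hz
  obtain ⟨m, hm⟩ := exists_pow_lt_of_lt_one hε ((div_lt_one hpos).2 hz)
  have hev : ∀ w, evalPoly ((MvPolynomial.C (evalPoly Q z)⁻¹ * Q) ^ m) w =
      ((evalPoly Q z)⁻¹ * evalPoly Q w) ^ m := fun w => by simp [evalPoly]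
  refine ⟨(MvPolynomial.C (evalPoly Q z)⁻¹ * Q) ^ m, ?_, fun w hw => ?_⟩
  · rw [hev, inv_mul_cancel₀ (norm_pos_iff.1 hpos), one_pow]
  · rw [hev, norm_pow, norm_mul, norm_inv, inv_mul_eq_div]
    refine le_trans ?_ hm.le
    gcongr
    exact hQ w hw

theorem exists_evalPoly_eq_one_of_isPolyConvex {n : ℕ} {K : Set (EuclideanSpace ℂ (Fin n))}
    (hK : IsCompact K) (hKpc : IsPolyConvex K) {z : EuclideanSpace ℂ (Fin n)} (hz : z ∉ K)
    {ε : ℝ} (hε : 0 < ε) :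
    ∃ P : MvPolynomial (Fin n) ℂ, evalPoly P z = 1 ∧ ∀ w ∈ K, ‖evalPoly P w‖ ≤ ε := by
  rw [← hKpc] at hz
  simp only [polyHull, Set.mem_ofPred_eq, not_forall, not_le] at hz
  obtain ⟨Q, hQ⟩ := hz
  exact exists_evalPoly_eq_one_of_lt
    (Real.iSup_nonneg fun w => Real.iSup_nonneg fun _ => norm_nonneg _)
    (fun w hw => norm_evalPoly_le_iSup hK Q hw) hQ hε

theorem exists_evalPoly_eq_inner {n : ℕ} (v p : EuclideanSpace ℂ (Fin n)) :
    ∃ Q : MvPolynomial (Fin n) ℂ, ∀ w, evalPoly Q w = inner ℂ v (w - p) := by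
  refine ⟨∑ i, MvPolynomial.C (conj (v i)) * (MvPolynomial.X i - MvPolynomial.C (p i)),
    fun w => ?_⟩
  simp only [evalPoly, PiLp.inner_apply, RCLike.inner_apply, PiLp.sub_apply, map_sum, map_mul, map_sub,
    MvPolynomial.eval_C, MvPolynomial.eval_X, mul_comm]

theorem isPolyConvex_closedBall {n : ℕ} (p : EuclideanSpace ℂ (Fin n)) {r : ℝ} (hr : 0 ≤ r) :
    IsPolyConvex (Metric.closedBall p r) := by
  refine Set.Subset.antisymm (fun z hz => ?_) (subset_polyHull (isCompact_closedBall p r))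
  obtain ⟨Q, hQ⟩ := exists_evalPoly_eq_inner (z - p) p
  have hle : ‖evalPoly Q z‖ ≤ ‖z - p‖ * r := by
    refine norm_evalPoly_le_of_mem_polyHull hz Q (by positivity) fun w hw => ?_
    rw [hQ]
    refine (norm_inner_le_norm _ _).trans ?_
    gcongr
    exact mem_closedBall_iff_norm.1 hw
  rw [hQ, inner_self_eq_norm_sq_to_K] at hle
  have hsq : ‖z - p‖ ^ 2 ≤ ‖z - p‖ * r := by simpa using hle
  rw [mem_closedBall_iff_norm]
  by_contra! hlt
  nlinarith [hr.trans_lt hlt]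

theorem norm_smoothstep_le {w : ℂ} (hw : ‖w‖ ≤ 1 / 8) : ‖w ^ 2 * (3 - 2 * w)‖ ≤ ‖w‖ / 2 := by
  have h : ‖3 - 2 * w‖ ≤ 3 + 2 * ‖w‖ := by
    simpa using norm_sub_le (3 : ℂ) (2 * w)
  rw [norm_mul, norm_pow]
  calc ‖w‖ ^ 2 * ‖3 - 2 * w‖ ≤ ‖w‖ ^ 2 * (3 + 2 * ‖w‖) := by gcongr
    _ ≤ ‖w‖ / 2 := by nlinarith [norm_nonneg w, mul_nonneg (norm_nonneg w) (sub_nonneg.2 hw)]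

/-- Iterating `w ↦ w² (3 - 2 w)`, which attracts to both `0` and `1`, improves a polynomial close
to `0` on `A` and close to `1` on `B` to one that is arbitrarily close. -/
theorem exists_evalPoly_separating {n : ℕ} {A B : Set (EuclideanSpace ℂ (Fin n))}
    {P : MvPolynomial (Fin n) ℂ} (hA : ∀ w ∈ A, ‖evalPoly P w‖ ≤ 1 / 8)
    (hB : ∀ w ∈ B, ‖1 - evalPoly P w‖ ≤ 1 / 8) {δ : ℝ} (hδ : 0 < δ) :
    ∃ f : MvPolynomial (Fin n) ℂ,
      (∀ w ∈ A, ‖evalPoly f w‖ ≤ δ) ∧ ∀ w ∈ B, ‖1 - evalPoly f w‖ ≤ δ := by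
  have key : ∀ j : ℕ, ∃ f : MvPolynomial (Fin n) ℂ,
      (∀ w ∈ A, ‖evalPoly f w‖ ≤ 1 / 8 * (1 / 2) ^ j) ∧
        ∀ w ∈ B, ‖1 - evalPoly f w‖ ≤ 1 / 8 * (1 / 2) ^ j := by
    intro j
    induction j with
    | zero => exact ⟨P, by simpa using hA, by simpa using hB⟩
    | succ j ih =>
      obtain ⟨f, hfA, hfB⟩ := ih
      have hj : (1 / 2 : ℝ) ^ j ≤ 1 := pow_le_one₀ (by norm_num) (by norm_num)
      have hev : ∀ w, evalPoly (f ^ 2 * (MvPolynomial.C 3 - MvPolynomial.C 2 * f)) w =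
          evalPoly f w ^ 2 * (3 - 2 * evalPoly f w) := fun w => by
        simp only [evalPoly, map_mul, map_pow, map_sub, MvPolynomial.eval_C]
      refine ⟨f ^ 2 * (MvPolynomial.C 3 - MvPolynomial.C 2 * f), fun w hw => ?_, fun w hw => ?_⟩
      · have h := hfA w hw
        have := norm_smoothstep_le (h.trans (by linarith))
        rw [hev, pow_succ (1 / 2 : ℝ)]
        linarith
      · have h := hfB w hw
        have := norm_smoothstep_le (h.trans (by linarith))
        rw [hev, pow_succ (1 / 2 : ℝ), show 1 - evalPoly f w ^ 2 * (3 - 2 * evalPoly f w) =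
          (1 - evalPoly f w) ^ 2 * (3 - 2 * (1 - evalPoly f w)) by ring]
        linarith
  obtain ⟨j, hj⟩ := exists_pow_lt_of_lt_one hδ (by norm_num : (1 / 2 : ℝ) < 1)
  obtain ⟨f, hfA, hfB⟩ := key j
  have hle : 1 / 8 * (1 / 2 : ℝ) ^ j ≤ δ := by
    have : (0 : ℝ) ≤ (1 / 2) ^ j := by positivity
    linarith
  exact ⟨f, fun w hw => (hfA w hw).trans hle, fun w hw => (hfB w hw).trans hle⟩

/-- A form of Kallin's lemma: the union of two compact polynomially convex sets is polynomially
convex if some polynomial is close to `0` on one and close to `1` on the other. -/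
theorem IsPolyConvex.union_of_separated {n : ℕ} {A B : Set (EuclideanSpace ℂ (Fin n))}
    (hA : IsCompact A) (hB : IsCompact B) (hApc : IsPolyConvex A) (hBpc : IsPolyConvex B)
    {P : MvPolynomial (Fin n) ℂ} (hPA : ∀ w ∈ A, ‖evalPoly P w‖ ≤ 1 / 8)
    (hPB : ∀ w ∈ B, ‖1 - evalPoly P w‖ ≤ 1 / 8) : IsPolyConvex (A ∪ B) := by
  refine Set.Subset.antisymm (fun z hz => ?_) (subset_polyHull (hA.union hB))
  by_contra hzAB
  obtain ⟨hzA, hzB⟩ := not_or.1 hzAB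
  obtain ⟨g, hgz, hgA⟩ := exists_evalPoly_eq_one_of_isPolyConvex hA hApc hzA
    (show (0 : ℝ) < 1 / 8 by norm_num)
  obtain ⟨h, hhz, hhB⟩ := exists_evalPoly_eq_one_of_isPolyConvex hB hBpc hzB
    (show (0 : ℝ) < 1 / 8 by norm_num)
  obtain ⟨C, hC⟩ := hB.exists_bound_of_continuousOn (continuous_evalPoly g).continuousOn
  obtain ⟨D, hD⟩ := hA.exists_bound_of_continuousOn (continuous_evalPoly h).continuousOn
  set M : ℝ := 1 + |C| + |D|
  have hM : 1 ≤ M := by linarith [abs_nonneg C, abs_nonneg D]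
  have hgB : ∀ w ∈ B, ‖evalPoly g w‖ ≤ M := fun w hw =>
    (hC w hw).trans (by linarith [le_abs_self C, abs_nonneg D])
  have hhA : ∀ w ∈ A, ‖evalPoly h w‖ ≤ M := fun w hw =>
    (hD w hw).trans (by linarith [le_abs_self D, abs_nonneg C])
  obtain ⟨f, hfA, hfB⟩ := exists_evalPoly_separating hPA hPB
    (show (0 : ℝ) < 1 / (4 * M) by positivity)
  have hδM : M * (1 / (4 * M)) = 1 / 4 := by field_simp
  have hδ : 1 / (4 * M) ≤ 1 := by rw [div_le_one (by positivity)]; linarith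
  have hev₁ : ∀ w, evalPoly (g * (1 - f)) w = evalPoly g w * (1 - evalPoly f w) :=
    fun w => by simp [evalPoly]
  have hev₂ : ∀ w, evalPoly (h * f) w = evalPoly h w * evalPoly f w :=
    fun w => by simp [evalPoly]
  have hone (w) : ‖1 - evalPoly f w‖ ≤ 1 + ‖evalPoly f w‖ := by
    simpa using norm_sub_le (1 : ℂ) (evalPoly f w)
  have hone' (w) : ‖evalPoly f w‖ ≤ 1 + ‖1 - evalPoly f w‖ := by
    simpa using norm_sub_le (1 : ℂ) (1 - evalPoly f w)
  have h₁ : ‖1 - evalPoly f z‖ ≤ 1 / 4 := by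
    have := norm_evalPoly_le_of_mem_polyHull hz (g * (1 - f)) (c := 1 / 4) (by norm_num) ?_
    · simpa [hev₁, hgz] using this
    rintro w (hw | hw) <;> rw [hev₁, norm_mul]
    · calc ‖evalPoly g w‖ * ‖1 - evalPoly f w‖ ≤ 1 / 8 * 2 :=
            mul_le_mul (hgA w hw) (by linarith [hone w, hfA w hw]) (norm_nonneg _) (by norm_num)
        _ = 1 / 4 := by norm_num
    · rw [← hδM]
      exact mul_le_mul (hgB w hw) (hfB w hw) (norm_nonneg _) (by positivity)
  have h₂ : ‖evalPoly f z‖ ≤ 1 / 4 := by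
    have := norm_evalPoly_le_of_mem_polyHull hz (h * f) (c := 1 / 4) (by norm_num) ?_
    · simpa [hev₂, hhz] using this
    rintro w (hw | hw) <;> rw [hev₂, norm_mul]
    · rw [← hδM]
      exact mul_le_mul (hhA w hw) (hfA w hw) (norm_nonneg _) (by positivity)
    · calc ‖evalPoly h w‖ * ‖evalPoly f w‖ ≤ 1 / 8 * 2 :=
            mul_le_mul (hhB w hw) (by linarith [hone' w, hfB w hw]) (norm_nonneg _) (by norm_num)
        _ = 1 / 4 := by norm_num
  have h₃ : ‖(1 : ℂ)‖ ≤ ‖1 - evalPoly f z‖ + ‖evalPoly f z‖ := by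
    simpa using norm_add_le (1 - evalPoly f z) (evalPoly f z)
  rw [norm_one] at h₃
  linarith

/-- If `K ⊆ ℂ^n` is compact and polynomially convex and `p ∉ K`, then there is `r > 0`
such that `K ∪ B̄_p(r')` is polynomially convex for every `0 < r' ≤ r`. -/
theorem polyConvex_union_closedBall
    (n : ℕ) (K : Set (EuclideanSpace ℂ (Fin n)))
    (hK : IsCompact K) (hKpc : IsPolyConvex K)
    (p : EuclideanSpace ℂ (Fin n)) (hp : p ∉ K) :
    ∃ r : ℝ, 0 < r ∧
      ∀ r' : ℝ, 0 < r' → r' ≤ r → IsPolyConvex (K ∪ Metric.closedBall p r') := by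
  obtain ⟨P, hPp, hPK⟩ := exists_evalPoly_eq_one_of_isPolyConvex hK hKpc hp
    (show (0 : ℝ) < 1 / 8 by norm_num)
  obtain ⟨r, hr, hball⟩ := Metric.nhds_basis_closedBall.eventually_iff.1
    ((continuous_evalPoly P).continuousAt.eventually
      (Metric.closedBall_mem_nhds (evalPoly P p) (show (0 : ℝ) < 1 / 8 by norm_num)))
  refine ⟨r, hr, fun r' hr' hle => hKpc.union_of_separated hK (isCompact_closedBall p r')
    (isPolyConvex_closedBall p hr'.le) hPK fun w hw => ?_⟩
  have := hball (Metric.closedBall_subset_closedBall hle hw)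
  rwa [hPp, dist_comm, dist_eq_norm] at this
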